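/- Let n be a nonempty finite index type and let K₁, K₂ : Matrix n n ℂ be such that each of the four matrices K₁†K₁, K₂†K₂, (K₁+K₂)†(K₁+K₂), and (K₁+iK₂)†(K₁+iK₂) is a complex scalar multiple of the identity matrix. Then there exist complex numbers c₁, c₂ and a unitary matrix W ∈ Matrix.unitaryGroup n ℂ such that K₁ = c₁ • W and K₂ = c₂ • W (i.e., K₁ and K₂ are proportional to the same unitary). -/

import Mathlib

open Matrix

open scoped ComplexOrder in
/-- A square complex matrix whose Gram matrix is scalar is a multiple of a unitary matrix. -/
theorem exists_eq_smul_unitary_of_conjTranspose_mul_self {n : Type*} [Fintype n] [DecidableEq n]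
    [Nonempty n] {K : Matrix n n ℂ} {c : ℂ} (h : Kᴴ * K = c • (1 : Matrix n n ℂ)) :
    ∃ (a : ℂ) (W : Matrix n n ℂ), W ∈ Matrix.unitaryGroup n ℂ ∧ K = a • W := by
  by_cases hK : K = 0
  · exact ⟨0, 1, one_mem _, by simp [hK]⟩
  have hc0 : c ≠ 0 := by
    rintro rfl
    exact hK (conjTranspose_mul_self_eq_zero.mp (by simpa using h))
  obtain ⟨i⟩ := ‹Nonempty n›
  have hc : 0 ≤ c := by
    simpa [h] using (posSemidef_conjTranspose_mul_self K).diag_nonneg (i := i)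
  obtain ⟨r, hr, rfl⟩ : ∃ r : ℝ, 0 ≤ r ∧ (r : ℂ) = c :=
    ⟨c.re, (Complex.le_def.mp hc).1, (Complex.eq_re_of_ofReal_le (r := 0) (by simpa using hc)).symm⟩
  have hsq : ((√r : ℝ) : ℂ) * (√r : ℝ) = r := by
    rw [← Complex.ofReal_mul, Real.mul_self_sqrt hr]
  have ha : ((√r : ℝ) : ℂ) ≠ 0 := by
    intro h0
    simp [h0] at hsq
    exact hc0 (by simp [← hsq])
  refine ⟨(√r : ℝ), ((√r : ℝ) : ℂ)⁻¹ • K, ?_, by rw [smul_inv_smul₀ ha]⟩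
  rw [Matrix.mem_unitaryGroup_iff', star_eq_conjTranspose, conjTranspose_smul, smul_mul_smul_comm,
    h, smul_smul, ← hsq]
  have : star ((√r : ℝ) : ℂ)⁻¹ = ((√r : ℝ) : ℂ)⁻¹ := by simp
  rw [this]
  field_simp
  simp

/-- Polarization: the cross Gram matrix is scalar if the four Gram matrices in the hypotheses
are. -/
theorem exists_conjTranspose_mul_eq_smul_one {n : Type*} [Fintype n] [DecidableEq n]
    {K₁ K₂ : Matrix n n ℂ}
    (h1 : ∃ c : ℂ, K₁ᴴ * K₁ = c • (1 : Matrix n n ℂ))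
    (h2 : ∃ c : ℂ, K₂ᴴ * K₂ = c • (1 : Matrix n n ℂ))
    (h3 : ∃ c : ℂ, (K₁ + K₂)ᴴ * (K₁ + K₂) = c • (1 : Matrix n n ℂ))
    (h4 : ∃ c : ℂ, (K₁ + Complex.I • K₂)ᴴ * (K₁ + Complex.I • K₂)
        = c • (1 : Matrix n n ℂ)) :
    ∃ d : ℂ, K₁ᴴ * K₂ = d • (1 : Matrix n n ℂ) := by
  obtain ⟨p, hp⟩ := h1
  obtain ⟨q, hq⟩ := h2
  obtain ⟨x, hx⟩ := h3
  obtain ⟨y, hy⟩ := h4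
  refine ⟨((x - p - q) - Complex.I * (y - p - q)) / 2, ?_⟩
  simp only [conjTranspose_add, conjTranspose_smul, add_mul, mul_add, smul_mul_assoc,
    mul_smul_comm, hp, hq] at hx hy
  ext i j
  have hx' := congrFun (congrFun hx i) j
  have hy' := congrFun (congrFun hy i) j
  simp only [Matrix.add_apply, Matrix.smul_apply, smul_eq_mul, Complex.star_def, Complex.conj_I] at hx' hy' ⊢
  linear_combination hx' / 2 - Complex.I / 2 * hy' +
    (((K₁ᴴ * K₂) i j - (K₂ᴴ * K₁) i j) / 2 -
      Complex.I * q * (1 : Matrix n n ℂ) i j / 2) * Complex.I_sq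

theorem stmt_0 {n : Type*} [Fintype n] [DecidableEq n] [Nonempty n]
    (K₁ K₂ : Matrix n n ℂ)
    (h1 : ∃ c : ℂ, K₁ᴴ * K₁ = c • (1 : Matrix n n ℂ))
    (h2 : ∃ c : ℂ, K₂ᴴ * K₂ = c • (1 : Matrix n n ℂ))
    (h3 : ∃ c : ℂ, (K₁ + K₂)ᴴ * (K₁ + K₂) = c • (1 : Matrix n n ℂ))
    (h4 : ∃ c : ℂ, (K₁ + Complex.I • K₂)ᴴ * (K₁ + Complex.I • K₂)
        = c • (1 : Matrix n n ℂ)) :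
    ∃ (c₁ c₂ : ℂ) (W : Matrix n n ℂ), W ∈ Matrix.unitaryGroup n ℂ ∧
      K₁ = c₁ • W ∧ K₂ = c₂ • W := by
  obtain ⟨d, hd⟩ := exists_conjTranspose_mul_eq_smul_one h1 h2 h3 h4
  obtain ⟨p, hp⟩ := h1
  obtain ⟨q, hq⟩ := h2
  obtain ⟨a, W, hW, rfl⟩ := exists_eq_smul_unitary_of_conjTranspose_mul_self hp
  by_cases ha : a = 0
  · obtain ⟨b, V, hV, hb⟩ := exists_eq_smul_unitary_of_conjTranspose_mul_self hq
    exact ⟨0, b, V, hV, by simp [ha], hb⟩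
  refine ⟨a, (star a)⁻¹ * d, W, hW, rfl, ?_⟩
  have hWW : W * Wᴴ = 1 := Matrix.mem_unitaryGroup_iff.mp hW
  have key : star a • K₂ = d • W := by
    simpa [← mul_assoc, hWW] using congrArg (W * ·) hd
  rw [← smul_smul, ← key, inv_smul_smul₀ (star_ne_zero.mpr ha)]
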